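/- Let γ be the standard Gaussian on ℝⁿ and ν = e^f γ with f twice continuously differentiable, finite second moment, finite relative entropy, finite Fisher information, Gaussian width D(ν) of K = {∇f(x)} finite, and Δf integrable with respect to ν. Then (1/2) I(ν) ≤ D_KL(ν||γ) − ∫ Δf dν + D(ν). -/

import Mathlib

open MeasureTheory Real
open scoped RealInnerProductSpace ENNReal

noncomputable def stdGaussian (n : ℕ) : Measure (EuclideanSpace ℝ (Fin n)) :=
  (volume : Measure (EuclideanSpace ℝ (Fin n))).withDensity
    fun x => ENNReal.ofReal ((2 * π) ^ (-(n : ℝ) / 2) * Real.exp (-‖x‖ ^ 2 / 2))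

noncomputable def lap {n : ℕ} (f : EuclideanSpace ℝ (Fin n) → ℝ)
    (x : EuclideanSpace ℝ (Fin n)) : ℝ :=
  ∑ i, fderiv ℝ (fun y => gradient f y) x (EuclideanSpace.single i 1) i

/-- `y ↦ sup_{t ∈ K} ⟨y, t⟩`. -/
noncomputable def gaussWidthFn {n : ℕ} (K : Set (EuclideanSpace ℝ (Fin n)))
    (y : EuclideanSpace ℝ (Fin n)) : ℝ :=
  ⨆ t : K, ⟪y, (t : EuclideanSpace ℝ (Fin n))⟫

def IsCoupling {n : ℕ}
    (p : Measure (EuclideanSpace ℝ (Fin n) × EuclideanSpace ℝ (Fin n)))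
    (ν γ : Measure (EuclideanSpace ℝ (Fin n))) : Prop :=
  p.map Prod.fst = ν ∧ p.map Prod.snd = γ

/-- Squared quadratic Wasserstein distance. -/
noncomputable def W2sq {n : ℕ} (ν γ : Measure (EuclideanSpace ℝ (Fin n))) : ℝ :=
  sInf {r : ℝ | ∃ p, IsCoupling p ν γ ∧ IsProbabilityMeasure p ∧
    r = ∫ q, ‖q.1 - q.2‖ ^ 2 ∂p}

theorem Real.volume_add_le_volume_of_isCompact {K L C : Set ℝ} (hK : IsCompact K)
    (hL : IsCompact L) (hK0 : K.Nonempty) (hL0 : L.Nonempty)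
    (h : ∀ x ∈ K, ∀ y ∈ L, x + y ∈ C) : volume K + volume L ≤ volume C := by
  obtain ⟨M, hM, hM'⟩ := hK.exists_isGreatest hK0
  obtain ⟨m, hm, hm'⟩ := hL.exists_isLeast hL0
  have hKm : volume ((fun x => x + m) '' K) = volume K := by
    rw [Set.image_add_right, measure_preimage_add_right]
  have hLM : volume ((fun y => M + y) '' L) = volume L := by
    rw [Set.image_add_left, measure_preimage_add]
  have hdisj : AEDisjoint volume ((fun x => x + m) '' K) ((fun y => M + y) '' L) := by
    refine measure_mono_null (t := {M + m}) ?_ (by simp)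
    rintro _ ⟨⟨x, hx, rfl⟩, ⟨y, hy, hxy⟩⟩
    have h1 := hM' hx
    have h2 := hm' hy
    simp only [Set.mem_singleton_iff] at hxy ⊢
    linarith
  rw [← hKm, ← hLM, ← measure_union₀ (hL.image (by fun_prop)).measurableSet.nullMeasurableSet hdisj]
  refine measure_mono ?_
  rintro _ (⟨x, hx, rfl⟩ | ⟨y, hy, rfl⟩)
  · exact h x hx m hm
  · exact h M hM y hy

/-- The one-dimensional Brunn–Minkowski inequality. -/
theorem Real.volume_add_le_volume {A B C : Set ℝ} (hA : MeasurableSet A) (hB : MeasurableSet B)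
    (hA0 : A.Nonempty) (hB0 : B.Nonempty)
    (h : ∀ x ∈ A, ∀ y ∈ B, x + y ∈ C) : volume A + volume B ≤ volume C := by
  obtain ⟨x₀, hx₀⟩ := hA0
  obtain ⟨y₀, hy₀⟩ := hB0
  rw [hA.measure_eq_iSup_isCompact, hB.measure_eq_iSup_isCompact]
  simp only [iSup_and']
  refine ENNReal.biSup_add_biSup_le' (p := fun K => K ⊆ A ∧ IsCompact K)
    (q := fun L => L ⊆ B ∧ IsCompact L) ⟨∅, by simp⟩ ⟨∅, by simp⟩ ?_
  rintro K ⟨hKA, hK⟩ L ⟨hLB, hL⟩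
  calc volume K + volume L ≤ volume (insert x₀ K) + volume (insert y₀ L) := by
        gcongr <;> exact Set.subset_insert _ _
    _ ≤ volume C := by
        refine Real.volume_add_le_volume_of_isCompact (hK.insert _) (hL.insert _)
          (Set.insert_nonempty _ _) (Set.insert_nonempty _ _) fun x hx y hy => h x ?_ y ?_
        · exact Set.insert_subset hx₀ hKA hx
        · exact Set.insert_subset hy₀ hLB hy

/-- Weighted AM-GM inequality in `ℝ≥0∞`. -/
theorem ENNReal.geom_mean_le_arith_mean2_weighted {a b : ℝ} (ha : 0 < a) (hb : 0 < b)
    (hab : a + b = 1) (x y : ℝ≥0∞) :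
    x ^ a * y ^ b ≤ ENNReal.ofReal a * x + ENNReal.ofReal b * y := by
  have hpq : a⁻¹.HolderConjugate b⁻¹ := by
    rw [Real.holderConjugate_iff]
    refine ⟨(one_lt_inv₀ ha).2 (by linarith), by simpa using hab⟩
  have := ENNReal.young_inequality (x ^ a) (y ^ b) hpq
  rwa [← ENNReal.rpow_mul, ← ENNReal.rpow_mul, mul_inv_cancel₀ ha.ne', mul_inv_cancel₀ hb.ne',
    ENNReal.rpow_one, ENNReal.rpow_one, ENNReal.ofReal_inv_of_pos ha,
    ENNReal.ofReal_inv_of_pos hb, div_eq_mul_inv, div_eq_mul_inv, inv_inv, inv_inv,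
    mul_comm x, mul_comm y] at this

/-- Layer cake formula for functions bounded by one. -/
theorem lintegral_eq_lintegral_meas_ofReal_lt {α : Type*} [MeasurableSpace α] (μ : Measure α)
    {f : α → ℝ≥0∞} (hf : Measurable f) (hf1 : ∀ x, f x ≤ 1) :
    ∫⁻ x, f x ∂μ = ∫⁻ t in Set.Ioi (0 : ℝ), μ {x | ENNReal.ofReal t < f x} := by
  have hfin : ∀ x, f x ≠ ∞ := fun x => ((hf1 x).trans_lt ENNReal.one_lt_top).ne
  have h := lintegral_eq_lintegral_meas_lt μ (f := fun x => (f x).toReal)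
    (Filter.Eventually.of_forall fun x => ENNReal.toReal_nonneg) hf.ennreal_toReal.aemeasurable
  simp only [ENNReal.ofReal_toReal (hfin _)] at h
  rw [h]
  refine setLIntegral_congr_fun measurableSet_Ioi fun t ht => ?_
  simp only [ENNReal.ofReal_lt_iff_lt_toReal (le_of_lt ht) (hfin _)]

theorem prekopa_leindler_real_of_iSup_eq_one {a b : ℝ} (ha : 0 < a) (hb : 0 < b)
    (hab : a + b = 1) {f g h : ℝ → ℝ≥0∞} (hf : Measurable f) (hg : Measurable g)
    (hh : Measurable h) (hf1 : ⨆ x, f x = 1) (hg1 : ⨆ x, g x = 1)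
    (H : ∀ x y, f x ^ a * g y ^ b ≤ h (a * x + b * y)) :
    ENNReal.ofReal a * (∫⁻ x, f x) + ENNReal.ofReal b * ∫⁻ x, g x ≤ ∫⁻ x, h x := by
  have hf1' : ∀ x, f x ≤ 1 := fun x => hf1 ▸ le_iSup f x
  have hg1' : ∀ x, g x ≤ 1 := fun x => hg1 ▸ le_iSup g x
  calc ENNReal.ofReal a * (∫⁻ x, f x) + ENNReal.ofReal b * ∫⁻ x, g x
      = (∫⁻ t in Set.Ioi (0 : ℝ), ENNReal.ofReal a * volume {x | ENNReal.ofReal t < f x})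
        + ∫⁻ t in Set.Ioi (0 : ℝ), ENNReal.ofReal b * volume {x | ENNReal.ofReal t < g x} := by
        rw [lintegral_eq_lintegral_meas_ofReal_lt _ hf hf1',
          lintegral_eq_lintegral_meas_ofReal_lt _ hg hg1',
          lintegral_const_mul' _ _ ENNReal.ofReal_ne_top,
          lintegral_const_mul' _ _ ENNReal.ofReal_ne_top]
    _ ≤ ∫⁻ t in Set.Ioi (0 : ℝ), (ENNReal.ofReal a * volume {x | ENNReal.ofReal t < f x}
        + ENNReal.ofReal b * volume {x | ENNReal.ofReal t < g x}) := le_lintegral_add _ _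
    _ ≤ ∫⁻ t in Set.Ioi (0 : ℝ), volume {x | ENNReal.ofReal t < min (h x) 1} := by
        refine setLIntegral_mono' measurableSet_Ioi fun t ht => ?_
        rcases le_or_gt 1 t with h1 | h1
        · have h1' : 1 ≤ ENNReal.ofReal t := by simpa using h1
          have e1 : {x | ENNReal.ofReal t < f x} = ∅ := by
            ext x; simpa using (hf1' x).trans h1'
          have e2 : {x | ENNReal.ofReal t < g x} = ∅ := by
            ext x; simpa using (hg1' x).trans h1'
          simp [e1, e2]
        · have h1' : ENNReal.ofReal t < 1 := by simpa using h1
          have ht0 : ENNReal.ofReal t ≠ 0 := by simpa using ht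
          have scale : ∀ {r : ℝ}, 0 < r → ∀ s : Set ℝ,
              ENNReal.ofReal r * volume s = volume ((fun x => r * x) '' s) := by
            intro r hr s
            have := Measure.addHaar_smul (volume : Measure ℝ) r s
            rw [Module.finrank_self, pow_one, abs_of_pos hr] at this
            exact this.symm
          rw [scale ha, scale hb]
          refine Real.volume_add_le_volume ?_ ?_ ?_ ?_ ?_
          · exact (MeasurableEquiv.mulLeft₀ a ha.ne').measurableSet_image.2
              (measurableSet_lt measurable_const hf)
          · exact (MeasurableEquiv.mulLeft₀ b hb.ne').measurableSet_image.2
              (measurableSet_lt measurable_const hg)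
          · exact Set.Nonempty.image _ (show ∃ x, ENNReal.ofReal t < f x from lt_iSup_iff.1 (hf1 ▸ h1'))
          · exact Set.Nonempty.image _ (show ∃ x, ENNReal.ofReal t < g x from lt_iSup_iff.1 (hg1 ▸ h1'))
          · rintro _ ⟨x, hx, rfl⟩ _ ⟨y, hy, rfl⟩
            simp only [Set.mem_ofPred_eq] at hx hy ⊢
            refine lt_min (lt_of_lt_of_le ?_ (H x y)) h1'
            calc ENNReal.ofReal t = ENNReal.ofReal t ^ a * ENNReal.ofReal t ^ b := by
                  rw [← ENNReal.rpow_add _ _ ht0 ENNReal.ofReal_ne_top, hab, ENNReal.rpow_one]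
              _ < f x ^ a * g y ^ b := by
                  exact ENNReal.mul_lt_mul (ENNReal.rpow_lt_rpow hx ha) (ENNReal.rpow_lt_rpow hy hb)
    _ = ∫⁻ x, min (h x) 1 :=
        (lintegral_eq_lintegral_meas_ofReal_lt _ (hh.min measurable_const)
          fun x => min_le_right _ _).symm
    _ ≤ ∫⁻ x, h x := lintegral_mono fun x => min_le_left _ _

theorem prekopa_leindler_real_of_bounded {a b : ℝ} (ha : 0 < a) (hb : 0 < b)
    (hab : a + b = 1) {f g h : ℝ → ℝ≥0∞} (hf : Measurable f) (hg : Measurable g)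
    (hh : Measurable h) (hf1 : ⨆ x, f x ≠ ∞) (hg1 : ⨆ x, g x ≠ ∞)
    (H : ∀ x y, f x ^ a * g y ^ b ≤ h (a * x + b * y)) :
    (∫⁻ x, f x) ^ a * (∫⁻ x, g x) ^ b ≤ ∫⁻ x, h x := by
  set A := ⨆ x, f x with hA
  set B := ⨆ x, g x with hB
  rcases eq_or_ne A 0 with hA0 | hA0
  · have : ∀ x, f x = 0 := fun x => le_antisymm (hA0 ▸ le_iSup f x) zero_le
    simp [this, ha]
  rcases eq_or_ne B 0 with hB0 | hB0
  · have : ∀ x, g x = 0 := fun x => le_antisymm (hB0 ▸ le_iSup g x) zero_le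
    simp [this, hb]
  have hAi : A⁻¹ ≠ ∞ := ENNReal.inv_ne_top.2 hA0
  have hBi : B⁻¹ ≠ ∞ := ENNReal.inv_ne_top.2 hB0
  have key := prekopa_leindler_real_of_iSup_eq_one ha hb hab (hf.const_mul A⁻¹)
    (hg.const_mul B⁻¹) (hh.const_mul ((A⁻¹) ^ a * (B⁻¹) ^ b))
    (by rw [← ENNReal.mul_iSup, ← hA, ENNReal.inv_mul_cancel hA0 hf1])
    (by rw [← ENNReal.mul_iSup, ← hB, ENNReal.inv_mul_cancel hB0 hg1])
    (fun x y => by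
      rw [ENNReal.mul_rpow_of_nonneg _ _ ha.le, ENNReal.mul_rpow_of_nonneg _ _ hb.le,
        mul_mul_mul_comm]
      gcongr
      exact H x y)
  have key2 := (ENNReal.geom_mean_le_arith_mean2_weighted ha hb hab _ _).trans key
  rw [lintegral_const_mul _ hf, lintegral_const_mul _ hg, lintegral_const_mul _ hh,
    ENNReal.mul_rpow_of_nonneg _ _ ha.le, ENNReal.mul_rpow_of_nonneg _ _ hb.le,
    mul_mul_mul_comm] at key2
  refine (ENNReal.mul_le_mul_iff_right ?_ ?_).1 key2
  · exact mul_ne_zero (ENNReal.rpow_pos (by simpa using hf1) hAi).ne'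
      (ENNReal.rpow_pos (by simpa using hg1) hBi).ne'
  · exact ENNReal.mul_ne_top (ENNReal.rpow_ne_top_of_nonneg ha.le hAi)
      (ENNReal.rpow_ne_top_of_nonneg hb.le hBi)

theorem prekopa_leindler_real {a b : ℝ} (ha : 0 < a) (hb : 0 < b)
    (hab : a + b = 1) {f g h : ℝ → ℝ≥0∞} (hf : Measurable f) (hg : Measurable g)
    (hh : Measurable h) (H : ∀ x y, f x ^ a * g y ^ b ≤ h (a * x + b * y)) :
    (∫⁻ x, f x) ^ a * (∫⁻ x, g x) ^ b ≤ ∫⁻ x, h x := by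
  rcases eq_or_ne (∫⁻ x, f x) 0 with hf0 | hf0
  · simp [hf0, ha]
  rcases eq_or_ne (∫⁻ x, g x) 0 with hg0 | hg0
  · simp [hg0, hb]
  have trunc : ∀ {u : ℝ → ℝ≥0∞}, Measurable u → Filter.Tendsto
      (fun k : ℕ => ∫⁻ x, min (u x) k) Filter.atTop (nhds (∫⁻ x, u x)) := by
    intro u hu
    refine lintegral_tendsto_of_tendsto_of_monotone
      (fun k => (hu.min measurable_const).aemeasurable)
      (Filter.Eventually.of_forall fun x k l hkl => ?_)
      (Filter.Eventually.of_forall fun x => ?_)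
    · exact min_le_min_left _ (by exact_mod_cast hkl)
    · have := (tendsto_const_nhds (x := u x)).min ENNReal.tendsto_nat_nhds_top
      simpa using this
  have lim : Filter.Tendsto
      (fun k : ℕ => (∫⁻ x, min (f x) k) ^ a * (∫⁻ x, min (g x) k) ^ b) Filter.atTop
      (nhds ((∫⁻ x, f x) ^ a * (∫⁻ x, g x) ^ b)) := by
    refine ENNReal.Tendsto.mul ((ENNReal.continuous_rpow_const.tendsto _).comp (trunc hf)) ?_
      ((ENNReal.continuous_rpow_const.tendsto _).comp (trunc hg)) ?_
    · left; simp [hf0, ha.not_gt]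
    · left; simp [hg0, hb.not_gt]
  have bdd : ∀ (u : ℝ → ℝ≥0∞) (k : ℕ), ⨆ x, min (u x) k ≠ ∞ := fun u k =>
    ne_top_of_le_ne_top (ENNReal.natCast_ne_top k) (iSup_le fun x => min_le_right _ _)
  refine le_of_tendsto' lim fun k => prekopa_leindler_real_of_bounded ha hb hab
    (hf.min measurable_const) (hg.min measurable_const) hh (bdd f k) (bdd g k) fun x y => ?_
  refine le_trans ?_ (H x y)
  gcongr <;> exact min_le_left _ _

theorem prekopa_leindler_pi {a b : ℝ} (ha : 0 < a) (hb : 0 < b) (hab : a + b = 1) :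
    ∀ {n : ℕ} {f g h : (Fin n → ℝ) → ℝ≥0∞}, Measurable f → Measurable g → Measurable h →
      (∀ x y, f x ^ a * g y ^ b ≤ h (a • x + b • y)) →
      (∫⁻ x, f x) ^ a * (∫⁻ x, g x) ^ b ≤ ∫⁻ x, h x
  | 0, f, g, h, hf, hg, hh, H => by
    have e : ∀ u : (Fin 0 → ℝ) → ℝ≥0∞, ∫⁻ x, u x = u 0 := fun u => by
      rw [volume_pi, Measure.pi_of_empty, lintegral_dirac' _ (measurable_of_finite u)]
      exact congrArg u (Subsingleton.elim _ _)
    simpa [e] using H 0 0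
  | n + 1, f, g, h, hf, hg, hh, H => by
    have hm : Measurable fun p : ℝ × (Fin n → ℝ) => (Fin.cons p.1 p.2 : Fin (n + 1) → ℝ) := by
      simpa [Fin.insertNthEquiv] using
        (MeasurableEquiv.piFinSuccAbove (fun _ : Fin (n + 1) => ℝ) 0).symm.measurable
    have split : ∀ {u : (Fin (n + 1) → ℝ) → ℝ≥0∞}, Measurable u →
        ∫⁻ x, u x = ∫⁻ t : ℝ, ∫⁻ z : Fin n → ℝ, u (Fin.cons t z) := by
      intro u hu
      rw [← ((volume_preserving_piFinSuccAbove (fun _ : Fin (n + 1) => ℝ) 0).symm).lintegral_comp hu]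
      have := lintegral_prod (μ := volume) (ν := volume) _ (hu.comp hm).aemeasurable
      simpa [Fin.insertNthEquiv, Measure.volume_eq_prod] using this
    rw [split hf, split hg, split hh]
    refine prekopa_leindler_real ha hb hab (hf.comp hm).lintegral_prod_right'
      (hg.comp hm).lintegral_prod_right' (hh.comp hm).lintegral_prod_right' fun s t => ?_
    refine prekopa_leindler_pi ha hb hab (hf.comp (hm.comp measurable_prodMk_left))
      (hg.comp (hm.comp measurable_prodMk_left)) (hh.comp (hm.comp measurable_prodMk_left))
      fun x y => ?_
    convert H (Fin.cons s x) (Fin.cons t y) using 2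
    ext i
    refine Fin.cases ?_ (fun j => ?_) i <;> simp

/-- The **Prékopa–Leindler inequality**. -/
theorem prekopa_leindler {a b : ℝ} (ha : 0 < a) (hb : 0 < b) (hab : a + b = 1) {n : ℕ}
    {f g h : EuclideanSpace ℝ (Fin n) → ℝ≥0∞} (hf : Measurable f) (hg : Measurable g)
    (hh : Measurable h) (H : ∀ x y, f x ^ a * g y ^ b ≤ h (a • x + b • y)) :
    (∫⁻ x, f x) ^ a * (∫⁻ x, g x) ^ b ≤ ∫⁻ x, h x := by
  have mp := PiLp.volume_preserving_toLp (Fin n)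
  rw [← mp.lintegral_comp hf, ← mp.lintegral_comp hg, ← mp.lintegral_comp hh]
  exact prekopa_leindler_pi ha hb hab (hf.comp mp.measurable) (hg.comp mp.measurable)
    (hh.comp mp.measurable) fun x y => H _ _

/-- Jensen's inequality for the exponential, without integrability of the exponential. -/
theorem ofReal_exp_integral_le_lintegral {α : Type*} [MeasurableSpace α] {μ : Measure α}
    [IsProbabilityMeasure μ] {g : α → ℝ} (hg : Integrable g μ) :
    ENNReal.ofReal (Real.exp (∫ x, g x ∂μ)) ≤ ∫⁻ x, ENNReal.ofReal (Real.exp (g x)) ∂μ := by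
  set m := ∫ x, g x ∂μ with hm
  have hgm : Integrable (fun x => g x - m) μ := hg.sub (integrable_const _)
  have h_int : Integrable (fun x => Real.exp m * (1 + (g x - m))) μ :=
    ((integrable_const _).add hgm).const_mul _
  have hval : ∫ x, Real.exp m * (1 + (g x - m)) ∂μ = Real.exp m := by
    rw [integral_const_mul, integral_add (integrable_const _) hgm,
      integral_sub hg (integrable_const _)]
    simp [← hm]
  calc ENNReal.ofReal (Real.exp m) = ENNReal.ofReal (∫ x, Real.exp m * (1 + (g x - m)) ∂μ) := by
        rw [hval]
    _ ≤ ENNReal.ofReal (∫ x, max (Real.exp m * (1 + (g x - m))) 0 ∂μ) := by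
        refine ENNReal.ofReal_le_ofReal ?_
        exact integral_mono h_int h_int.pos_part fun x => le_max_left _ _
    _ = ∫⁻ x, ENNReal.ofReal (max (Real.exp m * (1 + (g x - m))) 0) ∂μ :=
        ofReal_integral_eq_lintegral_ofReal h_int.pos_part
          (Filter.Eventually.of_forall fun x => le_max_right _ _)
    _ ≤ ∫⁻ x, ENNReal.ofReal (Real.exp (g x)) ∂μ := by
        refine lintegral_mono fun x => ENNReal.ofReal_le_ofReal (max_le ?_ (Real.exp_pos _).le)
        have h1 := Real.add_one_le_exp (g x - m)
        calc Real.exp m * (1 + (g x - m)) ≤ Real.exp m * Real.exp (g x - m) := by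
              gcongr; linarith
          _ = Real.exp (g x) := by rw [← Real.exp_add]; congr 1; ring

theorem lintegral_stdGaussian {n : ℕ} {g : EuclideanSpace ℝ (Fin n) → ℝ≥0∞}
    (hg : Measurable g) : ∫⁻ x, g x ∂(stdGaussian n) =
      ∫⁻ x, ENNReal.ofReal ((2 * π) ^ (-(n : ℝ) / 2) * Real.exp (-‖x‖ ^ 2 / 2)) * g x := by
  rw [stdGaussian, lintegral_withDensity_eq_lintegral_mul _ (by fun_prop) hg]
  rfl

instance isProbabilityMeasure_stdGaussian (n : ℕ) : IsProbabilityMeasure (stdGaussian n) := by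
  constructor
  have h2 := GaussianFourier.integral_rexp_neg_mul_sq_norm
    (V := EuclideanSpace ℝ (Fin n)) (b := 1 / 2) (by norm_num)
  have h3 : ∀ x : EuclideanSpace ℝ (Fin n), -(1 / 2) * ‖x‖ ^ 2 = -‖x‖ ^ 2 / 2 := fun x => by ring
  simp only [h3] at h2
  have hpos : 0 < (π / (1 / 2) : ℝ) ^ ((Module.finrank ℝ (EuclideanSpace ℝ (Fin n)) : ℝ) / 2) := by
    positivity
  have h_int : Integrable fun x : EuclideanSpace ℝ (Fin n) => Real.exp (-‖x‖ ^ 2 / 2) := by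
    by_contra h
    rw [integral_undef h] at h2
    exact hpos.ne h2
  rw [← lintegral_one, lintegral_stdGaussian measurable_const]
  simp only [mul_one]
  rw [← ofReal_integral_eq_lintegral_ofReal (h_int.const_mul _)
    (Filter.Eventually.of_forall fun x => by positivity), integral_const_mul, h2,
    finrank_euclideanSpace, Fintype.card_fin, neg_div, Real.rpow_neg (by positivity),
    show π / (1 / 2) = 2 * π by ring, inv_mul_cancel₀ (by positivity), ENNReal.ofReal_one]

/-- Gaussian transport inequality in Maurey's dual form. -/
theorem lintegral_stdGaussian_rpow_mul_le_one {a b : ℝ} (ha : 0 < a) (hb : 0 < b)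
    (hab : a + b = 1) {n : ℕ} {u v : EuclideanSpace ℝ (Fin n) → ℝ} (hu : Measurable u)
    (hv : Measurable v) (H : ∀ x y, a * u x + b * v y ≤ a * b / 2 * ‖x - y‖ ^ 2) :
    (∫⁻ x, ENNReal.ofReal (Real.exp (u x)) ∂(stdGaussian n)) ^ a *
      (∫⁻ x, ENNReal.ofReal (Real.exp (v x)) ∂(stdGaussian n)) ^ b ≤ 1 := by
  have hone : ∫⁻ _, 1 ∂(stdGaussian n) = 1 := by simp
  rw [lintegral_stdGaussian (by fun_prop), lintegral_stdGaussian (by fun_prop), ← hone,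
    lintegral_stdGaussian (by fun_prop)]
  refine prekopa_leindler ha hb hab (by fun_prop) (by fun_prop) (by fun_prop) fun x y => ?_
  set c : ℝ := (2 * π) ^ (-(n : ℝ) / 2) with hc
  have hc0 : 0 < c := by positivity
  have e : ∀ (s t : ℝ) {r : ℝ}, 0 < r →
      (ENNReal.ofReal (c * Real.exp s) * ENNReal.ofReal (Real.exp t)) ^ r =
        ENNReal.ofReal (c ^ r * Real.exp (r * (s + t))) := by
    intro s t r hr
    rw [← ENNReal.ofReal_mul (by positivity), mul_assoc, ← Real.exp_add,
      ENNReal.ofReal_rpow_of_pos (by positivity), Real.mul_rpow hc0.le (by positivity),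
      ← Real.exp_mul, mul_comm r]
  rw [e _ _ ha, e _ _ hb, ← ENNReal.ofReal_mul (by positivity), mul_one]
  refine ENNReal.ofReal_le_ofReal ?_
  calc c ^ a * Real.exp (a * (-‖x‖ ^ 2 / 2 + u x)) * (c ^ b * Real.exp (b * (-‖y‖ ^ 2 / 2 + v y)))
      = c ^ a * c ^ b *
        Real.exp (a * (-‖x‖ ^ 2 / 2 + u x) + b * (-‖y‖ ^ 2 / 2 + v y)) := by
        rw [Real.exp_add]; ring
    _ = c * Real.exp (a * (-‖x‖ ^ 2 / 2 + u x) + b * (-‖y‖ ^ 2 / 2 + v y)) := by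
        rw [← Real.rpow_add hc0, hab, Real.rpow_one]
    _ ≤ c * Real.exp (-‖a • x + b • y‖ ^ 2 / 2) := by
        gcongr
        have h1 := H x y
        rw [norm_sub_sq_real] at h1
        rw [norm_add_sq_real, norm_smul, norm_smul, real_inner_smul_left, real_inner_smul_right,
          Real.norm_of_nonneg ha.le, Real.norm_of_nonneg hb.le]
        obtain rfl : b = 1 - a := by linarith
        linarith

theorem measurable_gaussWidthFn {n : ℕ} {K : Set (EuclideanSpace ℝ (Fin n))}
    (hK : ∀ y : EuclideanSpace ℝ (Fin n),
      BddAbove (Set.range fun t : K => ⟪y, (t : EuclideanSpace ℝ (Fin n))⟫)) :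
    Measurable (gaussWidthFn K) :=
  (lowerSemicontinuous_ciSup hK fun _ =>
    (continuous_id.inner continuous_const).lowerSemicontinuous).measurable

/-- A Tsirelson-type inequality combined with the Gibbs variational principle. -/
theorem integral_inner_sub_le_integral_gaussWidthFn {n : ℕ} {b : ℝ} (hb : 0 < b) (hb1 : b < 1)
    {f : EuclideanSpace ℝ (Fin n) → ℝ} {G : EuclideanSpace ℝ (Fin n) → EuclideanSpace ℝ (Fin n)}
    (hf : Measurable f) (hG : Measurable G)
    {ν : Measure (EuclideanSpace ℝ (Fin n))} [IsProbabilityMeasure ν]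
    (hν : ν = (stdGaussian n).withDensity fun x => ENNReal.ofReal (Real.exp (f x)))
    (h_int : Integrable (fun x => ⟪x, G x⟫ - ‖G x‖ ^ 2 / (2 * b) - f x) ν)
    (hbdd : ∀ y : EuclideanSpace ℝ (Fin n),
      BddAbove (Set.range fun t : Set.range G => ⟪y, (t : EuclideanSpace ℝ (Fin n))⟫))
    (hD : Integrable (gaussWidthFn (Set.range G)) (stdGaussian n)) :
    ∫ x, (⟪x, G x⟫ - ‖G x‖ ^ 2 / (2 * b) - f x) ∂ν
      ≤ ∫ y, gaussWidthFn (Set.range G) y ∂(stdGaussian n) := by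
  set h := gaussWidthFn (Set.range G) with hh
  have hhm : Measurable h := measurable_gaussWidthFn hbdd
  set a := 1 - b with ha_def
  have ha : 0 < a := by linarith
  have hle : ∀ x y, ⟪y, G x⟫ ≤ h y := fun x y => le_ciSup (hbdd y) ⟨G x, x, rfl⟩
  have hφ : Measurable fun x => ⟪x, G x⟫ - ‖G x‖ ^ 2 / (2 * b) := by fun_prop
  have key := lintegral_stdGaussian_rpow_mul_le_one ha hb (by linarith : a + b = 1)
    (u := fun x => ⟪x, G x⟫ - ‖G x‖ ^ 2 / (2 * b)) (v := fun y => -(a / b) * h y)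
    hφ (by fun_prop) (fun x y => by
      have h1 : b * (-(a / b) * h y) = -(a * h y) := by field_simp
      have h2 : 0 ≤ a / (2 * b) * ‖G x - b • (x - y)‖ ^ 2 := by positivity
      rw [norm_sub_sq_real, norm_smul, Real.norm_of_nonneg hb.le, real_inner_smul_right,
        inner_sub_right, real_inner_comm x (G x), real_inner_comm y (G x)] at h2
      have h3 : a / (2 * b) * (‖G x‖ ^ 2 - 2 * (b * (⟪x, G x⟫ - ⟪y, G x⟫))
          + (b * ‖x - y‖) ^ 2) = a * (‖G x‖ ^ 2 / (2 * b)) - a * ⟪x, G x⟫ + a * ⟪y, G x⟫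
          + a * b / 2 * ‖x - y‖ ^ 2 := by
        field_simp
        ring
      have h4 := mul_le_mul_of_nonneg_left (hle x y) ha.le
      rw [h1]
      linarith)
  have hU : ENNReal.ofReal (Real.exp (∫ x, (⟪x, G x⟫ - ‖G x‖ ^ 2 / (2 * b) - f x) ∂ν)) ≤
      ∫⁻ x, ENNReal.ofReal (Real.exp (⟪x, G x⟫ - ‖G x‖ ^ 2 / (2 * b))) ∂(stdGaussian n) := by
    refine (ofReal_exp_integral_le_lintegral h_int).trans_eq ?_
    rw [hν, lintegral_withDensity_eq_lintegral_mul _ (by fun_prop) (by fun_prop)]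
    refine lintegral_congr fun x => ?_
    rw [Pi.mul_apply, ← ENNReal.ofReal_mul (by positivity), ← Real.exp_add]
    congr 2
    ring
  have hV := ofReal_exp_integral_le_lintegral (hD.const_mul (-(a / b)))
  have := (mul_le_mul' (ENNReal.rpow_le_rpow hU ha.le) (ENNReal.rpow_le_rpow hV hb.le)).trans key
  rw [ENNReal.ofReal_rpow_of_pos (by positivity), ENNReal.ofReal_rpow_of_pos (by positivity),
    ← ENNReal.ofReal_mul (by positivity), ENNReal.ofReal_le_one, ← Real.exp_mul, ← Real.exp_mul,
    ← Real.exp_add, Real.exp_le_one_iff, integral_const_mul] at this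
  have h5 : -(a / b) * (∫ y, h y ∂(stdGaussian n)) * b = -(a * ∫ y, h y ∂(stdGaussian n)) := by
    field_simp
  rw [h5] at this
  exact le_of_mul_le_mul_left (by linarith) ha

theorem ContinuousLinearMap.sum_apply_single_mul {n : ℕ} (L : EuclideanSpace ℝ (Fin n) →L[ℝ] ℝ)
    (v : EuclideanSpace ℝ (Fin n)) : ∑ i, L (EuclideanSpace.single i 1) * v i = L v := by
  conv_rhs => rw [← (EuclideanSpace.basisFun (Fin n) ℝ).sum_repr v]
  simp [map_sum, mul_comm]

/-- Integration by parts of the divergence of a `C¹` vector field against a compactly supported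
test function. -/
theorem integral_mul_divergence_eq_neg {n : ℕ}
    {V : EuclideanSpace ℝ (Fin n) → EuclideanSpace ℝ (Fin n)} (hV : ContDiff ℝ 1 V)
    {χ : EuclideanSpace ℝ (Fin n) → ℝ} (hχ : ContDiff ℝ 1 χ) (hc : HasCompactSupport χ) :
    ∫ x, χ x * ∑ i, fderiv ℝ V x (EuclideanSpace.single i 1) i = -∫ x, fderiv ℝ χ x (V x) := by
  have hVi : ∀ i, ContDiff ℝ 1 fun x => V x i := fun i => by fun_prop
  have hd : ∀ i x v, fderiv ℝ (fun y => V y i) x v = fderiv ℝ V x v i := fun i x v => by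
    have h1 := ((EuclideanSpace.proj (𝕜 := ℝ) i).hasFDerivAt.comp x
      (hV.differentiable one_ne_zero x).hasFDerivAt).fderiv
    exact congrArg (fun L => L v) h1
  have hχ' : Continuous (fderiv ℝ χ) := hχ.continuous_fderiv one_ne_zero
  have hVi' : ∀ i, Continuous (fderiv ℝ fun x => V x i) :=
    fun i => (hVi i).continuous_fderiv one_ne_zero
  have hc' : HasCompactSupport (fderiv ℝ χ) := hc.fderiv ℝ
  have int1 : ∀ i, Integrable fun x =>
      fderiv ℝ χ x (EuclideanSpace.single i 1) * V x i := fun i => by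
    refine Continuous.integrable_of_hasCompactSupport
      ((hχ'.clm_apply continuous_const).mul (hVi i).continuous) ?_
    exact (hc'.comp_left (g := fun L => L (EuclideanSpace.single i 1)) rfl).mul_right
  have int2 : ∀ i, Integrable fun x =>
      χ x * fderiv ℝ (fun y => V y i) x (EuclideanSpace.single i 1) := fun i =>
    Continuous.integrable_of_hasCompactSupport
      (hχ.continuous.mul ((hVi' i).clm_apply continuous_const)) hc.mul_right
  have int3 : ∀ i, Integrable fun x => χ x * V x i := fun i =>
    Continuous.integrable_of_hasCompactSupport
      (hχ.continuous.mul (hVi i).continuous) hc.mul_right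
  have hsum : ∀ x, fderiv ℝ χ x (V x) =
      ∑ i, fderiv ℝ χ x (EuclideanSpace.single i 1) * V x i := fun x =>
    (ContinuousLinearMap.sum_apply_single_mul _ _).symm
  simp only [← hd, Finset.mul_sum, hsum]
  rw [integral_finsetSum _ fun i _ => int2 i, integral_finsetSum _ fun i _ => int1 i,
    ← Finset.sum_neg_distrib]
  refine Finset.sum_congr rfl fun i _ => ?_
  exact integral_mul_fderiv_eq_neg_fderiv_mul_of_integrable (int1 i) (int2 i) (int3 i)
    (fun x _ => hχ.differentiable one_ne_zero x) (fun x _ => (hVi i).differentiable one_ne_zero x)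

/-- The divergence of an integrable `C¹` vector field integrates to zero if it is integrable. -/
theorem integral_divergence_eq_zero {n : ℕ}
    {V : EuclideanSpace ℝ (Fin n) → EuclideanSpace ℝ (Fin n)} (hV : ContDiff ℝ 1 V)
    (hVint : Integrable V)
    (hdiv : Integrable fun x => ∑ i, fderiv ℝ V x (EuclideanSpace.single i 1) i) :
    ∫ x, ∑ i, fderiv ℝ V x (EuclideanSpace.single i 1) i = 0 := by
  let φ : ContDiffBump (0 : EuclideanSpace ℝ (Fin n)) := ⟨1, 2, one_pos, one_lt_two⟩
  have hφ : ContDiff ℝ 1 (φ : EuclideanSpace ℝ (Fin n) → ℝ) := φ.contDiff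
  obtain ⟨C, hC⟩ := (hφ.continuous_fderiv one_ne_zero).bounded_above_of_compact_support
    (φ.hasCompactSupport.fderiv ℝ)
  let ε : ℕ → ℝ := fun k => 1 / ((k : ℝ) + 1)
  have hε0 : ∀ k, 0 < ε k := fun k => by positivity
  have hε : Filter.Tendsto ε Filter.atTop (nhds 0) := tendsto_one_div_add_atTop_nhds_zero_nat
  let χ : ℕ → EuclideanSpace ℝ (Fin n) → ℝ := fun k x => φ (ε k • x)
  have hχ : ∀ k, ContDiff ℝ 1 (χ k) := fun k => hφ.comp (contDiff_const_smul _)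
  have hχc : ∀ k, HasCompactSupport (χ k) := fun k =>
    φ.hasCompactSupport.comp_homeomorph (Homeomorph.smulOfNeZero (ε k) (hε0 k).ne')
  have hχd : ∀ k x v, fderiv ℝ (χ k) x v = ε k * fderiv ℝ φ (ε k • x) v := fun k x v => by
    have h1 : HasFDerivAt (fun x : EuclideanSpace ℝ (Fin n) => ε k • x)
      (ε k • ContinuousLinearMap.id ℝ _) x := (hasFDerivAt_id x).const_smul (ε k)
    have h2 := ((hφ.differentiable one_ne_zero (ε k • x)).hasFDerivAt.comp x h1).fderiv
    have h3 : fderiv ℝ (χ k) x v = fderiv ℝ φ (ε k • x) (ε k • v) := congrArg (fun L => L v) h2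
    rw [h3, map_smul, smul_eq_mul]
  have lim1 : Filter.Tendsto
      (fun k => ∫ x, χ k x * ∑ i, fderiv ℝ V x (EuclideanSpace.single i 1) i) Filter.atTop
      (nhds (∫ x, ∑ i, fderiv ℝ V x (EuclideanSpace.single i 1) i)) := by
    refine tendsto_integral_of_dominated_convergence
      (fun x => ‖∑ i, fderiv ℝ V x (EuclideanSpace.single i 1) i‖)
      (fun k => (hχ k).continuous.aestronglyMeasurable.mul hdiv.aestronglyMeasurable) hdiv.norm
      (fun k => Filter.Eventually.of_forall fun x => ?_) (Filter.Eventually.of_forall fun x => ?_)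
    · rw [norm_mul, Real.norm_of_nonneg φ.nonneg]
      exact mul_le_of_le_one_left (norm_nonneg _) φ.le_one
    · have h1 : Filter.Tendsto (fun k => χ k x) Filter.atTop (nhds 1) := by
        have h2 := (hφ.continuous.tendsto _).comp (hε.smul_const x)
        rw [zero_smul, φ.one_of_mem_closedBall (by simp [φ])] at h2
        exact h2
      simpa using h1.mul_const (∑ i, fderiv ℝ V x (EuclideanSpace.single i 1) i)
  have lim2 : Filter.Tendsto (fun k => -∫ x, fderiv ℝ (χ k) x (V x)) Filter.atTop (nhds 0) := by
    have h0 : Filter.Tendsto (fun k => ε k * (C * ∫ x, ‖V x‖)) Filter.atTop (nhds 0) := by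
      simpa using hε.mul_const (C * ∫ x, ‖V x‖)
    refine squeeze_zero_norm (fun k => ?_) h0
    rw [norm_neg, ← integral_const_mul, ← integral_const_mul]
    refine norm_integral_le_of_norm_le ((hVint.norm.const_mul _).const_mul _)
      (Filter.Eventually.of_forall fun x => ?_)
    rw [hχd, norm_mul, Real.norm_of_nonneg (hε0 k).le]
    exact mul_le_mul_of_nonneg_left (((fderiv ℝ φ (ε k • x)).le_opNorm _).trans
      (mul_le_mul_of_nonneg_right (hC _) (norm_nonneg _))) (hε0 k).le
  simp only [← integral_mul_divergence_eq_neg hV (hχ _) (hχc _)] at lim2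
  exact tendsto_nhds_unique lim1 lim2

theorem ContDiff.gradient {n : ℕ} {f : EuclideanSpace ℝ (Fin n) → ℝ} (hf : ContDiff ℝ 2 f) :
    ContDiff ℝ 1 (gradient f) :=
  (InnerProductSpace.toDual ℝ (EuclideanSpace ℝ (Fin n))).symm.toContinuousLinearEquiv.contDiff.comp
    (hf.fderiv_right (by norm_num))

/-- Integration by parts for the weighted measure `e ^ f γ`. -/
theorem integral_inner_gradient_eq {n : ℕ} {f : EuclideanSpace ℝ (Fin n) → ℝ}
    {ν : Measure (EuclideanSpace ℝ (Fin n))} [IsProbabilityMeasure ν] (hf : ContDiff ℝ 2 f)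
    (hν : ν = (stdGaussian n).withDensity fun x => ENNReal.ofReal (Real.exp (f x)))
    (hinner : Integrable (fun x => ⟪x, gradient f x⟫) ν)
    (hfish : Integrable (fun x => ‖gradient f x‖ ^ 2) ν) (hlap : Integrable (lap f) ν) :
    ∫ x, ⟪x, gradient f x⟫ ∂ν = ∫ x, lap f x ∂ν + ∫ x, ‖gradient f x‖ ^ 2 ∂ν := by
  have hG : ContDiff ℝ 1 (gradient f) := hf.gradient
  have hfc : Continuous f := hf.continuous
  set c : ℝ := (2 * π) ^ (-(n : ℝ) / 2) with hc
  have hc0 : 0 < c := by positivity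
  let ρ : EuclideanSpace ℝ (Fin n) → ℝ := fun x => c * Real.exp (f x - ‖x‖ ^ 2 / 2)
  have hρ0 : ∀ x, 0 ≤ ρ x := fun x => by positivity
  have hρc : Continuous ρ := by fun_prop
  have hν' : ν = volume.withDensity fun x => ENNReal.ofReal (ρ x) := by
    rw [hν, stdGaussian, ← withDensity_mul _ (by fun_prop) (by fun_prop)]
    congr 1
    ext x
    rw [Pi.mul_apply, ← ENNReal.ofReal_mul (by positivity), mul_assoc, ← Real.exp_add]
    congr 3
    ring
  have h_int : ∀ {F : Type} [NormedAddCommGroup F] [NormedSpace ℝ F]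
      {g : EuclideanSpace ℝ (Fin n) → F}, Integrable g ν → Integrable fun x => ρ x • g x := by
    intro F _ _ g hg
    rw [hν', integrable_withDensity_iff_integrable_smul' (by fun_prop)
      (Filter.Eventually.of_forall fun x => ENNReal.ofReal_lt_top)] at hg
    simpa only [ENNReal.toReal_ofReal (hρ0 _)] using hg
  have hρd : ∀ x, HasFDerivAt ρ (ρ x • (fderiv ℝ f x - innerSL ℝ x)) x := fun x => by
    have h1 : HasFDerivAt (fun x : EuclideanSpace ℝ (Fin n) => ‖x‖ ^ 2 / 2) (innerSL ℝ x) x := by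
      refine (((hasStrictFDerivAt_norm_sq x).hasFDerivAt.mul_const (1 / 2 : ℝ)).congr_fderiv
        ?_).congr_of_eventuallyEq ?_
      · ext v; simp
      · exact Filter.Eventually.of_forall fun y => by simp [div_eq_mul_inv]
    refine (((hf.differentiable two_ne_zero x).hasFDerivAt.sub h1).exp.const_mul c).congr_fderiv ?_
    rw [smul_smul]
    rfl
  have hρC : ContDiff ℝ 1 ρ := contDiff_const.mul
    (((hf.of_le (by norm_num)).sub ((contDiff_norm_sq ℝ).div_const 2)).exp)
  have hdiv : ∀ x, ∑ i, fderiv ℝ (fun x => ρ x • gradient f x) x (EuclideanSpace.single i 1) i =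
      ρ x • (lap f x + ‖gradient f x‖ ^ 2 - ⟪x, gradient f x⟫) := fun x => by
    have h1 := ((hρd x).smul (hG.differentiable one_ne_zero x).hasFDerivAt).fderiv
    have h2 : fderiv ℝ f x (gradient f x) = ‖gradient f x‖ ^ 2 := by
      rw [← toDual_gradient, InnerProductSpace.toDual_apply_apply, real_inner_self_eq_norm_sq]
    have h3 : ∀ i, fderiv ℝ (fun x => ρ x • gradient f x) x (EuclideanSpace.single i 1) i =
        ρ x * fderiv ℝ (fun y => gradient f y) x (EuclideanSpace.single i 1) i
          + (ρ x • (fderiv ℝ f x - innerSL ℝ x)) (EuclideanSpace.single i 1) * gradient f x i :=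
      fun i => by
        have h4 := congrArg (fun L => L (EuclideanSpace.single i 1) i) h1
        exact h4
    simp only [h3]
    rw [Finset.sum_add_distrib, ContinuousLinearMap.sum_apply_single_mul, ← Finset.mul_sum, ← lap]
    simp only [smul_apply, sub_apply, h2, innerSL_apply_apply,
      smul_eq_mul]
    ring
  have hsum : Integrable (fun x => lap f x + ‖gradient f x‖ ^ 2) ν := hlap.add hfish
  have hGint : Integrable (gradient f) ν :=
    ((memLp_two_iff_integrable_sq_norm hG.continuous.aestronglyMeasurable).2 hfish).integrable
      one_le_two
  have key := integral_divergence_eq_zero (V := fun x => ρ x • gradient f x) (hρC.smul hG)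
    (h_int hGint) (by
    simp only [hdiv]
    exact h_int (hsum.sub hinner))
  simp only [hdiv] at key
  have h0 : ∫ x, (lap f x + ‖gradient f x‖ ^ 2 - ⟪x, gradient f x⟫) ∂ν = 0 := by
    rw [hν', integral_withDensity_eq_integral_toReal_smul (by fun_prop)
      (Filter.Eventually.of_forall fun x => ENNReal.ofReal_lt_top)]
    simpa only [ENNReal.toReal_ofReal (hρ0 _)] using key
  rw [integral_sub hsum hinner, integral_add hlap hfish] at h0
  linarith

theorem reverse_log_sobolev_laplacian (n : ℕ)
    (f : EuclideanSpace ℝ (Fin n) → ℝ) (ν : Measure (EuclideanSpace ℝ (Fin n)))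
    (hf : ContDiff ℝ 2 f)
    (hν : ν = (stdGaussian n).withDensity fun x => ENNReal.ofReal (Real.exp (f x)))
    (hprob : IsProbabilityMeasure ν)
    (hsec : Integrable (fun x => ‖x‖ ^ 2) ν)
    (hent : Integrable f ν)
    (hfish : Integrable (fun x => ‖gradient f x‖ ^ 2) ν)
    (hlap : Integrable (lap f) ν)
    (hbdd : ∀ y : EuclideanSpace ℝ (Fin n),
      BddAbove (Set.range fun t : Set.range (gradient f) =>
        ⟪y, (t : EuclideanSpace ℝ (Fin n))⟫))
    (hD : Integrable (gaussWidthFn (Set.range (gradient f))) (stdGaussian n)) :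
    (1 / 2) * ∫ x, ‖gradient f x‖ ^ 2 ∂ν
      ≤ ∫ x, f x ∂ν - ∫ x, lap f x ∂ν
        + ∫ y, gaussWidthFn (Set.range (gradient f)) y ∂(stdGaussian n) := by
  have hG : Continuous (gradient f) := hf.gradient.continuous
  have hinner : Integrable (fun x => ⟪x, gradient f x⟫) ν := by
    refine (hsec.add hfish).mono' (continuous_id.inner hG).aestronglyMeasurable
      (Filter.Eventually.of_forall fun x => (norm_inner_le_norm _ _).trans ?_)
    simp only [Pi.add_apply]
    nlinarith [sq_nonneg (‖x‖ - ‖gradient f x‖), sq_nonneg ‖x‖, sq_nonneg ‖gradient f x‖]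
  have hparts := integral_inner_gradient_eq hf hν hinner hfish hlap
  have hlim : Filter.Tendsto (fun b : ℝ => ∫ x, ⟪x, gradient f x⟫ ∂ν
      - (∫ x, ‖gradient f x‖ ^ 2 ∂ν) / (2 * b) - ∫ x, f x ∂ν) (nhdsWithin 1 (Set.Iio 1))
      (nhds (∫ x, ⟪x, gradient f x⟫ ∂ν
        - (∫ x, ‖gradient f x‖ ^ 2 ∂ν) / (2 * 1) - ∫ x, f x ∂ν)) := by
    refine Filter.Tendsto.mono_left ?_ nhdsWithin_le_nhds
    refine ContinuousAt.tendsto (f := fun b : ℝ => ∫ x, ⟪x, gradient f x⟫ ∂ν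
      - (∫ x, ‖gradient f x‖ ^ 2 ∂ν) / (2 * b) - ∫ x, f x ∂ν) ?_
    fun_prop (disch := norm_num)
  have hbound := le_of_tendsto hlim (b := ∫ y, gaussWidthFn (Set.range (gradient f)) y
      ∂(stdGaussian n)) (by
    filter_upwards [Ioo_mem_nhdsLT (zero_lt_one (α := ℝ))] with b hb
    have h1 : Integrable (fun x => ⟪x, gradient f x⟫ - ‖gradient f x‖ ^ 2 / (2 * b)) ν :=
      hinner.sub (hfish.div_const (2 * b))
    have := integral_inner_sub_le_integral_gaussWidthFn hb.1 hb.2 hf.continuous.measurable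
      hG.measurable hν (h1.sub hent) hbdd hD
    rwa [integral_sub h1 hent, integral_sub hinner (hfish.div_const _), integral_div] at this)
  linarith
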